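/- There exist an absolute constant h_0 ∈ ℕ, an absolute constant c ∈ (0,1), and a universal constant c' > 0 with the following property. For every H ≥ h_0, every ε with 2^{−cH} < ε < 1/(100H), and every ℓ ∈ {2, …, H} with ε^{−ℓ} ≤ 2^H, setting N = ⌊1/(6ε^ℓ)⌋, there exists a policy class Π of cardinality N over the layered state space with layers S_h = {j[h] : j ∈ [2^{2H}]} ∪ {j'[h] : j ∈ [2^{2H}]} (two states of each index j per layer) and action set A = {0,1}, such that: (1) for every index j ∈ [2^{2H}], the set Π_j = {π ∈ Π : π(j[h]) = 1 for some h ∈ [H]} has cardinality in [εN/2, 2εN]; (2) every π ∈ Π belongs to Π_j for at least (ε/2)·2^{2H} indices j; (3) every π ∈ Π satisfies π(j[h]) = π(j'[h]) for all j and h, and for every j the map π ↦ (π(j[1]), …, π(j[H])) is injective on Π_j; and (4) the spanning capacity satisfies 𝔠(Π) ≤ c'·H^{4ℓ+2}. -/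

import Mathlib

/-- A deterministic MDP over a layered state space. -/
structure DetMDP (S : ℕ → Type) (A : Type) where
  start : S 0
  step : ∀ h : ℕ, S h → A → S (h + 1)

/-- The trajectory of a policy in a deterministic MDP. -/
def DetMDP.traj {S : ℕ → Type} {A : Type} (M : DetMDP S A) (π : ∀ h : ℕ, S h → A) :
    ∀ h : ℕ, S h
  | 0 => M.start
  | h + 1 => M.step h (M.traj π h) (π h (M.traj π h))

/-- Reachability of a state-action pair at layer `h` by the class `P` in `M`. -/
def Reachable {S : ℕ → Type} {A : Type} (M : DetMDP S A) (P : Set (∀ h : ℕ, S h → A))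
    (h : ℕ) (s : S h) (a : A) : Prop :=
  ∃ π ∈ P, M.traj π h = s ∧ π h s = a

/-- Cumulative reachability at layer `h`. -/
noncomputable def Creach {S : ℕ → Type} {A : Type} (M : DetMDP S A)
    (P : Set (∀ h : ℕ, S h → A)) (h : ℕ) : ℕ :=
  Set.ncard {p : S h × A | Reachable M P h p.1 p.2}

/-- Spanning capacity of `P` with horizon `H`. -/
noncomputable def spanCap (H : ℕ) (S : ℕ → Type) (A : Type)
    (P : Set (∀ h : ℕ, S h → A)) : ℕ :=
  sSup {n : ℕ | ∃ h < H, ∃ M : DetMDP S A, n = Creach M P h}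

section span

variable {C : Type} [DecidableEq C] {N : ℕ}

lemma good_card (M : DetMDP (fun _ => C × Bool) Bool)
    (pol : Fin N → (∀ _ : ℕ, C × Bool → Bool)) (J : Finset C) (Q : Finset (Fin N)) (t : ℕ)
    (hQ : (Q.image (fun i => M.traj (pol i) t)).card ≤ 1) (d : ℕ) :
    ((Q.filter (fun i => ∀ v, t ≤ v → v < t + d →
        pol i v (M.traj (pol i) v) = true → (M.traj (pol i) v).1 ∈ J)).image
      (fun i => M.traj (pol i) (t + d))).card ≤ 1 + 2 * J.card * d := by
  induction d with
  | zero =>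
    refine le_trans (Finset.card_le_card ?_) (le_trans hQ (by simp))
    exact Finset.image_subset_image (Finset.filter_subset _ _)
  | succ d ih =>
    set R := (Q.filter (fun i => ∀ v, t ≤ v → v < t + d →
        pol i v (M.traj (pol i) v) = true → (M.traj (pol i) v).1 ∈ J)).image
      (fun i => M.traj (pol i) (t + d)) with hR
    have hsub : ((Q.filter (fun i => ∀ v, t ≤ v → v < t + (d + 1) →
        pol i v (M.traj (pol i) v) = true → (M.traj (pol i) v).1 ∈ J)).image
      (fun i => M.traj (pol i) (t + (d + 1)))) ⊆
        R.image (fun s => M.step (t + d) s false) ∪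
        (J ×ˢ (Finset.univ : Finset Bool)).image (fun s => M.step (t + d) s true) := by
      intro s hs
      simp only [Finset.mem_image, Finset.mem_filter] at hs
      obtain ⟨i, ⟨hiQ, hi⟩, rfl⟩ := hs
      have hst : M.traj (pol i) (t + (d + 1)) =
        M.step (t + d) (M.traj (pol i) (t + d)) (pol i (t + d) (M.traj (pol i) (t + d))) := rfl
      rw [Finset.mem_union]
      by_cases hb : pol i (t + d) (M.traj (pol i) (t + d)) = true
      · right
        rw [Finset.mem_image]
        refine ⟨M.traj (pol i) (t + d), ?_, ?_⟩
        · simp only [Finset.mem_product, Finset.mem_univ, and_true]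
          exact hi (t + d) (by omega) (by omega) hb
        · rw [hst, hb]
      · left
        rw [Finset.mem_image]
        refine ⟨M.traj (pol i) (t + d), ?_, ?_⟩
        · rw [hR, Finset.mem_image]
          refine ⟨i, ?_, rfl⟩
          rw [Finset.mem_filter]
          exact ⟨hiQ, fun v h1 h2 => hi v h1 (by omega)⟩
        · rw [hst]; simp only [Bool.not_eq_true] at hb; rw [hb]
    have h1 := Finset.card_le_card hsub
    have h2 := Finset.card_union_le (R.image (fun s => M.step (t + d) s false))
      ((J ×ˢ (Finset.univ : Finset Bool)).image (fun s => M.step (t + d) s true))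
    have h3 : (R.image (fun s => M.step (t + d) s false)).card ≤ R.card := Finset.card_image_le
    have h4 : ((J ×ˢ (Finset.univ : Finset Bool)).image
      (fun s => M.step (t + d) s true)).card ≤ J.card * 2 := by
      refine Finset.card_image_le.trans ?_
      simp
    nlinarith

lemma reach_card (M : DetMDP (fun _ => C × Bool) Bool)
    (pol : Fin N → (∀ _ : ℕ, C × Bool → Bool)) (B : Fin N → C → Bool) (H ℓ k h : ℕ)
    (hh : h < H) (hl : ℓ ≤ H) (hk : 1 ≤ k)
    (hB : ∀ i v s, v < H → pol i v s = true → B i s.1 = true)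
    (hblock : ∀ J : Finset C, J.card = ℓ →
      (Finset.univ.filter (fun i => ∀ j ∈ J, B i j = true)).card ≤ k) (n : ℕ) :
    ∀ (J : Finset C) (Q : Finset (Fin N)) (t : ℕ), J.card + n = ℓ → t ≤ h →
      (∀ i ∈ Q, ∀ j ∈ J, B i j = true) →
      (Q.image (fun i => M.traj (pol i) t)).card ≤ 1 →
      (Q.image (fun i => M.traj (pol i) h)).card ≤ k * (4 * H ^ 3) ^ n := by
  induction n with
  | zero =>
    intro J Q t hJ _ hQJ _
    have := hblock J (by simpa using hJ)
    refine Finset.card_image_le.trans (le_trans (Finset.card_le_card ?_) (by simpa using this))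
    intro i hi
    simpa using hQJ i hi
  | succ n ih =>
    intro J Q t hJ ht hQJ hQ
    set F := k * (4 * H ^ 3) ^ n with hF
    have hHpos : 1 ≤ H := by omega
    have hF1 : 1 ≤ F := Nat.mul_pos hk (by positivity)
    let G : ℕ → Finset (Fin N) := fun u => Q.filter (fun i => ∀ v, t ≤ v → v < u →
        pol i v (M.traj (pol i) v) = true → (M.traj (pol i) v).1 ∈ J)
    let R : ℕ → Finset (C × Bool) := fun u => (G u).image (fun i => M.traj (pol i) u)
    have hRc : ∀ u, t ≤ u → u ≤ h → (R u).card ≤ 2 * H ^ 2 := by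
      intro u h1 h2
      obtain ⟨d, rfl⟩ := Nat.exists_eq_add_of_le h1
      refine (good_card M pol J Q t hQ d).trans ?_
      have : J.card * d ≤ (H - 1) * H := Nat.mul_le_mul (by omega) (by omega)
      obtain ⟨m, rfl⟩ : ∃ m, H = m + 1 := ⟨H - 1, by omega⟩
      simp only [Nat.add_sub_cancel] at this
      nlinarith
    let Qs : ℕ → C × Bool → Finset (Fin N) := fun u s =>
      Q.filter (fun i => M.traj (pol i) u = s ∧ pol i u s = true)
    have hsub : Q.image (fun i => M.traj (pol i) h) ⊆
        R h ∪ (Finset.Ico t h).biUnion (fun u =>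
          ((R u).filter (fun s => s.1 ∉ J)).biUnion (fun s =>
            (Qs u s).image (fun i => M.traj (pol i) h))) := by
      intro x hx
      rw [Finset.mem_image] at hx
      obtain ⟨i, hi, rfl⟩ := hx
      rw [Finset.mem_union]
      by_cases hg : i ∈ G h
      · left; exact Finset.mem_image_of_mem _ hg
      · right
        have hex : ∃ v, t ≤ v ∧ v < h ∧ pol i v (M.traj (pol i) v) = true ∧
            (M.traj (pol i) v).1 ∉ J := by
          by_contra hcon
          push Not at hcon
          exact hg (Finset.mem_filter.2 ⟨hi, hcon⟩)
        classical
        obtain ⟨h1, h2, h3, h4⟩ := Nat.find_spec hex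
        set u := Nat.find hex with hu
        rw [Finset.mem_biUnion]
        refine ⟨u, Finset.mem_Ico.2 ⟨h1, h2⟩, ?_⟩
        rw [Finset.mem_biUnion]
        refine ⟨M.traj (pol i) u, ?_, ?_⟩
        · rw [Finset.mem_filter]
          refine ⟨?_, h4⟩
          refine Finset.mem_image.2 ⟨i, ?_, rfl⟩
          refine Finset.mem_filter.2 ⟨hi, ?_⟩
          intro v hv1 hv2 hv3
          by_contra hv4
          exact Nat.find_min hex hv2 ⟨hv1, by omega, hv3, hv4⟩
        · refine Finset.mem_image.2 ⟨i, ?_, rfl⟩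
          exact Finset.mem_filter.2 ⟨hi, rfl, h3⟩
    have hsmall : ∀ u ∈ Finset.Ico t h, ∀ s ∈ (R u).filter (fun s => s.1 ∉ J),
        ((Qs u s).image (fun i => M.traj (pol i) h)).card ≤ F := by
      intro u hu s hs
      rw [Finset.mem_Ico] at hu
      rw [Finset.mem_filter] at hs
      refine ih (insert s.1 J) (Qs u s) (u + 1) ?_ (by omega) ?_ ?_
      · rw [Finset.card_insert_of_notMem hs.2]; omega
      · intro i hi j hj
        obtain ⟨hiQ, his, hip⟩ := Finset.mem_filter.1 hi
        rcases Finset.mem_insert.1 hj with rfl | hj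
        · exact hB i u s (by omega) hip
        · exact hQJ i hiQ j hj
      · have : (Qs u s).image (fun i => M.traj (pol i) (u + 1)) ⊆ {M.step u s true} := by
          intro x hx
          obtain ⟨i, hi, rfl⟩ := Finset.mem_image.1 hx
          obtain ⟨hiQ, his, hip⟩ := Finset.mem_filter.1 hi
          rw [Finset.mem_singleton]
          change M.step u (M.traj (pol i) u) (pol i u (M.traj (pol i) u)) = _
          rw [his, hip]
        simpa using Finset.card_le_card this
    have hU : ((Finset.Ico t h).biUnion (fun u =>
          ((R u).filter (fun s => s.1 ∉ J)).biUnion (fun s =>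
            (Qs u s).image (fun i => M.traj (pol i) h)))).card ≤ H * (2 * H ^ 2 * F) := by
      refine (Finset.card_biUnion_le_card_mul _ _ (2 * H ^ 2 * F) ?_).trans ?_
      · intro u hu
        refine (Finset.card_biUnion_le_card_mul _ _ F (hsmall u hu)).trans ?_
        rw [Finset.mem_Ico] at hu
        exact Nat.mul_le_mul_right _
          ((Finset.card_le_card (Finset.filter_subset _ _)).trans (hRc u hu.1 hu.2.le))
      · refine Nat.mul_le_mul_right _ ?_
        rw [Nat.card_Ico]; omega
    have h1 := (Finset.card_le_card hsub).trans (Finset.card_union_le _ _)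
    have h2 := hRc h ht le_rfl
    have h3 : 2 * H ^ 2 ≤ 2 * H ^ 3 * F := by
      have : H ^ 2 ≤ H ^ 3 := Nat.pow_le_pow_right hHpos (by norm_num)
      nlinarith
    have h4 : k * (4 * H ^ 3) ^ (n + 1) = 2 * H ^ 3 * F + H * (2 * H ^ 2 * F) := by
      rw [hF]; ring
    rw [h4]
    omega

lemma spanCap_bound [Inhabited C]
    (pol : Fin N → (∀ _ : ℕ, C × Bool → Bool)) (B : Fin N → C → Bool) (H ℓ k : ℕ)
    (hH : 1 ≤ H) (hl : ℓ ≤ H) (hk : 1 ≤ k)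
    (hB : ∀ i v s, v < H → pol i v s = true → B i s.1 = true)
    (hblock : ∀ J : Finset C, J.card = ℓ →
      (Finset.univ.filter (fun i => ∀ j ∈ J, B i j = true)).card ≤ k) :
    spanCap H (fun _ => C × Bool) Bool (Set.range pol) ≤ 2 * (k * (4 * H ^ 3) ^ ℓ) := by
  unfold spanCap
  refine csSup_le ⟨_, 0, by omega, ⟨default, fun _ _ _ => default⟩, rfl⟩ ?_
  rintro n ⟨h, hh, M, rfl⟩
  have h1 := reach_card M pol B H ℓ k h hh hl hk hB hblock ℓ ∅ Finset.univ 0 (by simp)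
    (Nat.zero_le _) (by simp) (by
      have : Finset.univ.image (fun i => M.traj (pol i) 0) ⊆ {M.start} := by
        intro x hx
        obtain ⟨i, _, rfl⟩ := Finset.mem_image.1 hx
        simp [DetMDP.traj]
      simpa using Finset.card_le_card this)
  unfold Creach
  have hsub : {p : (C × Bool) × Bool | Reachable M (Set.range pol) h p.1 p.2} ⊆
      ↑((Finset.univ.image (fun i => M.traj (pol i) h)) ×ˢ (Finset.univ : Finset Bool)) := by
    rintro ⟨s, a⟩ ⟨_, ⟨i, rfl⟩, hs, _⟩
    simp only [Finset.coe_product, Set.mem_prod, Finset.mem_coe, Finset.mem_image,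
      Finset.mem_univ, and_true, true_and]
    exact ⟨i, hs⟩
  refine (Set.ncard_le_ncard hsub (Finset.finite_toSet _)).trans ?_
  rw [Set.ncard_coe_finset, Finset.card_product]
  simp only [Finset.card_univ, Fintype.card_bool]
  omega

end span

section prob

lemma weight_sum {ι : Type*} [Fintype ι] [DecidableEq ι] (ε x y : ℝ) (T : Finset ι) :
    ∑ f : ι → Bool, (∏ i, (if f i = true then ε else 1 - ε)) *
      ∏ i ∈ T, (if f i = true then x else y) = (ε * x + (1 - ε) * y) ^ T.card := by
  have h1 : ∀ f : ι → Bool, (∏ i, (if f i = true then ε else 1 - ε)) *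
      ∏ i ∈ T, (if f i = true then x else y) =
      ∏ i, (if f i = true then ε else 1 - ε) *
        (if i ∈ T then (if f i = true then x else y) else 1) := by
    intro f
    rw [Finset.prod_mul_distrib]
    congr 1
    rw [Finset.prod_ite_mem, Finset.univ_inter]
  simp_rw [h1]
  have h2 := Finset.prod_univ_sum (fun _ : ι => (Finset.univ : Finset Bool))
    (fun i b => (if b = true then ε else 1 - ε) *
        (if i ∈ T then (if b = true then x else y) else 1))
  rw [Fintype.piFinset_univ] at h2
  rw [← h2]
  have h3 : ∀ i : ι, ∑ b : Bool, (if b = true then ε else 1 - ε) *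
        (if i ∈ T then (if b = true then x else y) else 1) =
        if i ∈ T then (ε * x + (1 - ε) * y) else 1 := by
    intro i
    by_cases hi : i ∈ T <;> simp [hi]
  simp_rw [h3]
  rw [Finset.prod_ite_mem, Finset.univ_inter, Finset.prod_const]

lemma exists_of_avg {α : Type*} [Fintype α] (W Φ : α → ℝ) (hW : ∀ a, 0 ≤ W a)
    (h1 : ∑ a, W a = 1) (h2 : ∑ a, W a * Φ a < 1) : ∃ a, Φ a < 1 := by
  by_contra hcon
  push Not at hcon
  have : ∑ a, W a ≤ ∑ a, W a * Φ a :=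
    Finset.sum_le_sum fun a _ => le_mul_of_one_le_right (hW a) (hcon a)
  linarith

lemma lower_tail (ε : ℝ) (n H : ℕ) (h0 : 0 < ε) (h1 : ε < 1) (hn : 16 * (H : ℝ) ≤ ε * n) :
    (2 : ℝ) ^ (ε * n / 2) * (ε * (1 / 2) + (1 - ε) * 1) ^ n ≤ Real.exp (-(2.4 * H)) := by
  have hlog := Real.log_two_lt_d9
  have e1 : (2 : ℝ) ^ (ε * n / 2) = Real.exp (Real.log 2 * (ε * n / 2)) :=
    Real.rpow_def_of_pos (by norm_num) _
  have e2 : (ε * (1 / 2) + (1 - ε) * 1) ^ n ≤ Real.exp (-(ε / 2) * n) := by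
    have : ε * (1 / 2) + (1 - ε) * 1 ≤ Real.exp (-(ε / 2)) := by
      have := Real.add_one_le_exp (-(ε / 2)); linarith
    calc _ ≤ (Real.exp (-(ε / 2))) ^ n := pow_le_pow_left₀ (by linarith) this n
      _ = _ := by rw [← Real.exp_nat_mul]; ring_nf
  rw [e1]
  calc _ ≤ Real.exp (Real.log 2 * (ε * n / 2)) * Real.exp (-(ε / 2) * n) := by gcongr
    _ = Real.exp (Real.log 2 * (ε * n / 2) + -(ε / 2) * n) := by rw [Real.exp_add]
    _ ≤ _ := by
      apply Real.exp_le_exp.2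
      have hp : 0 ≤ ε * n := by positivity
      nlinarith

lemma upper_tail (ε : ℝ) (n H : ℕ) (h0 : 0 < ε) (h1 : ε < 1) (hn : 16 * (H : ℝ) ≤ ε * n) :
    (2 : ℝ) ^ (-(2 * ε * n)) * (ε * 2 + (1 - ε) * 1) ^ n ≤ Real.exp (-(2.4 * H)) := by
  have hlog := Real.log_two_gt_d9
  have e1 : (2 : ℝ) ^ (-(2 * ε * n)) = Real.exp (Real.log 2 * (-(2 * ε * n))) :=
    Real.rpow_def_of_pos (by norm_num) _
  have e2 : (ε * 2 + (1 - ε) * 1) ^ n ≤ Real.exp (ε * n) := by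
    have : ε * 2 + (1 - ε) * 1 ≤ Real.exp ε := by
      have := Real.add_one_le_exp ε; linarith
    calc _ ≤ (Real.exp ε) ^ n := pow_le_pow_left₀ (by linarith) this n
      _ = _ := by rw [← Real.exp_nat_mul]; ring_nf
  rw [e1]
  calc _ ≤ Real.exp (Real.log 2 * (-(2 * ε * n))) * Real.exp (ε * n) := by gcongr
    _ = Real.exp (Real.log 2 * (-(2 * ε * n)) + ε * n) := by rw [Real.exp_add]
    _ ≤ _ := by
      apply Real.exp_le_exp.2
      have hp : 0 ≤ ε * n := by positivity
      nlinarith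

lemma four_pow_mul (H : ℕ) : (4 : ℝ) ^ H * Real.exp (-(2.4 * H)) ≤ (2 / 5) ^ H := by
  have h4 : (4 : ℝ) ≤ Real.exp 1.4 := by
    have hlog := Real.log_two_lt_d9
    have : (4 : ℝ) = Real.exp (Real.log 2 + Real.log 2) := by
      rw [Real.exp_add, Real.exp_log (by norm_num)]; norm_num
    rw [this]; apply Real.exp_le_exp.2; linarith
  have h5 : Real.exp (-1) ≤ 2 / 5 := by
    have := Real.exp_neg_one_lt_d9; linarith
  calc (4 : ℝ) ^ H * Real.exp (-(2.4 * H)) ≤ (Real.exp 1.4) ^ H * Real.exp (-(2.4 * H)) := by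
        gcongr
    _ = (Real.exp (-1)) ^ H := by
        rw [← Real.exp_nat_mul, ← Real.exp_nat_mul, ← Real.exp_add]; ring_nf
    _ ≤ _ := pow_le_pow_left₀ (Real.exp_pos _).le h5 H

lemma prod_ite_one {ι : Type*} (T : Finset ι) (f : ι → Bool) (x : ℝ) :
    ∏ i ∈ T, (if f i = true then x else 1) = x ^ (T.filter (fun i => f i = true)).card := by
  rw [← Finset.prod_filter, Finset.prod_const]

lemma exists_matrix (N D H ℓ : ℕ) (ε : ℝ) (h0 : 0 < ε) (h1 : ε < 1)
    (hN : 16 * (H : ℝ) ≤ ε * N) (hD : 16 * (H : ℝ) ≤ ε * D) (hDe : D = 4 ^ H) (hND : N ≤ D)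
    (hNe : N * ε ^ ℓ ≤ 1 / 6) (hl : 2 ≤ ℓ) (hH : 10 ≤ H) :
    ∃ B : Fin N → Fin D → Bool,
      (∀ j, ε * N / 2 ≤ ((Finset.univ.filter (fun i => B i j = true)).card : ℝ) ∧
        ((Finset.univ.filter (fun i => B i j = true)).card : ℝ) ≤ 2 * ε * N) ∧
      (∀ i, ε / 2 * D ≤ ((Finset.univ.filter (fun j => B i j = true)).card : ℝ)) ∧
      (∀ J : Finset (Fin D), J.card = ℓ →
        (Finset.univ.filter (fun i => ∀ j ∈ J, B i j = true)).card ≤ H * ℓ) := by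
  classical
  let col : Fin D → Finset (Fin N × Fin D) := fun j => Finset.univ ×ˢ {j}
  let row : Fin N → Finset (Fin N × Fin D) := fun i => {i} ×ˢ Finset.univ
  let PI := (Finset.univ : Finset (Fin N)).powersetCard (H * ℓ)
  let PJ := (Finset.univ : Finset (Fin D)).powersetCard ℓ
  let Pr : Finset (Fin N × Fin D) → ℝ → ℝ → ((Fin N × Fin D) → Bool) → ℝ :=
    fun T x y f => ∏ i ∈ T, (if f i = true then x else y)
  let W : ((Fin N × Fin D) → Bool) → ℝ := fun f => ∏ i, (if f i = true then ε else 1 - ε)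
  have hWT : ∀ T x y, ∑ f, W f * Pr T x y f = (ε * x + (1 - ε) * y) ^ T.card :=
    fun T x y => weight_sum ε x y T
  let Φ1 : ((Fin N × Fin D) → Bool) → ℝ := fun f => ∑ j, (2 : ℝ) ^ (ε * N / 2) * Pr (col j) (1 / 2) 1 f
  let Φ2 : ((Fin N × Fin D) → Bool) → ℝ := fun f => ∑ j, (2 : ℝ) ^ (-(2 * ε * N)) * Pr (col j) 2 1 f
  let Φ3 : ((Fin N × Fin D) → Bool) → ℝ := fun f => ∑ i, (2 : ℝ) ^ (ε * D / 2) * Pr (row i) (1 / 2) 1 f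
  let Φ4 : ((Fin N × Fin D) → Bool) → ℝ := fun f => ∑ p ∈ PI ×ˢ PJ, Pr (p.1 ×ˢ p.2) 1 0 f
  have hW0 : ∀ f, 0 ≤ W f := fun f => Finset.prod_nonneg fun i _ => by split_ifs <;> linarith
  have hPr0 : ∀ T x y f, 0 ≤ x → 0 ≤ y → 0 ≤ Pr T x y f := fun T x y f hx hy =>
    Finset.prod_nonneg fun i _ => by split_ifs <;> assumption
  have hW1 : ∑ f, W f = 1 := by
    have := hWT ∅ 1 1
    simpa [Pr] using this
  have hpull : ∀ {κ : Type} (s : Finset κ) (a : ℝ) (T : κ → Finset (Fin N × Fin D)) (x y : ℝ),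
      ∑ f, W f * ∑ j ∈ s, a * Pr (T j) x y f =
        ∑ j ∈ s, a * (ε * x + (1 - ε) * y) ^ (T j).card := by
    intro κ s a T x y
    simp_rw [Finset.mul_sum]
    rw [Finset.sum_comm]
    refine Finset.sum_congr rfl fun j _ => ?_
    rw [← hWT, Finset.mul_sum]
    exact Finset.sum_congr rfl fun f _ => by ring
  have hcolc : ∀ j, (col j).card = N := fun j => by simp [col]
  have hrowc : ∀ i, (row i).card = D := fun i => by simp [row]
  have hDr : (D : ℝ) = 4 ^ H := by rw [hDe]; push_cast; rfl
  have hNDr : (N : ℝ) ≤ 4 ^ H := by rw [← hDr]; exact_mod_cast hND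
  have hbase := four_pow_mul H
  have b1 : ∑ f, W f * Φ1 f ≤ (2 / 5) ^ H := by
    rw [hpull]
    simp only [hcolc, Finset.sum_const, Finset.card_univ, Fintype.card_fin, nsmul_eq_mul]
    rw [hDr]
    exact (mul_le_mul_of_nonneg_left (lower_tail ε N H h0 h1 hN) (by positivity)).trans hbase
  have b2 : ∑ f, W f * Φ2 f ≤ (2 / 5) ^ H := by
    rw [hpull]
    simp only [hcolc, Finset.sum_const, Finset.card_univ, Fintype.card_fin, nsmul_eq_mul]
    rw [hDr]
    exact (mul_le_mul_of_nonneg_left (upper_tail ε N H h0 h1 hN) (by positivity)).trans hbase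
  have b3 : ∑ f, W f * Φ3 f ≤ (2 / 5) ^ H := by
    rw [hpull]
    simp only [hrowc, Finset.sum_const, Finset.card_univ, Fintype.card_fin, nsmul_eq_mul]
    refine le_trans (mul_le_mul hNDr (lower_tail ε D H h0 h1 hD) ?_ (by positivity)) hbase
    have : 0 ≤ ε * (1 / 2) + (1 - ε) * 1 := by linarith
    positivity
  have b4 : ∑ f, W f * Φ4 f ≤ (2 / 3) ^ H := by
    have e := hpull (PI ×ˢ PJ) 1 (fun p => p.1 ×ˢ p.2) 1 0
    simp only [one_mul] at e
    change ∑ f, W f * ∑ p ∈ PI ×ˢ PJ, Pr (p.1 ×ˢ p.2) 1 0 f ≤ _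
    rw [e]
    have hc : ∀ p ∈ PI ×ˢ PJ, (ε * 1 + (1 - ε) * 0) ^ (p.1 ×ˢ p.2).card = ε ^ (H * ℓ * ℓ) := by
      intro p hp
      rw [Finset.mem_product, Finset.mem_powersetCard, Finset.mem_powersetCard] at hp
      rw [Finset.card_product, hp.1.2, hp.2.2]; ring
    rw [Finset.sum_congr rfl hc, Finset.sum_const, nsmul_eq_mul, Finset.card_product,
      Finset.card_powersetCard, Finset.card_powersetCard]
    simp only [Finset.card_univ, Fintype.card_fin]
    have c1 : (N.choose (H * ℓ) : ℝ) ≤ (N : ℝ) ^ (H * ℓ) := by exact_mod_cast Nat.choose_le_pow _ _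
    have c2 : (D.choose ℓ : ℝ) ≤ (4 : ℝ) ^ (H * ℓ) := by
      rw [pow_mul, ← hDr]; exact_mod_cast Nat.choose_le_pow _ _
    push_cast
    calc (N.choose (H * ℓ) : ℝ) * (D.choose ℓ) * ε ^ (H * ℓ * ℓ)
        ≤ (N : ℝ) ^ (H * ℓ) * (4 : ℝ) ^ (H * ℓ) * ε ^ (H * ℓ * ℓ) := by gcongr
      _ = (N * ε ^ ℓ * 4) ^ (H * ℓ) := by
        rw [mul_pow, mul_pow, ← pow_mul]; ring
      _ ≤ (2 / 3) ^ (H * ℓ) := by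
        apply pow_le_pow_left₀ (by positivity); linarith
      _ ≤ (2 / 3) ^ H := pow_le_pow_of_le_one (by norm_num) (by norm_num)
          (Nat.le_mul_of_pos_right _ (by omega))
  have htot : ∑ f, W f * (Φ1 f + Φ2 f + Φ3 f + Φ4 f) < 1 := by
    have e : ∑ f, W f * (Φ1 f + Φ2 f + Φ3 f + Φ4 f) = ∑ f, W f * Φ1 f + ∑ f, W f * Φ2 f +
        ∑ f, W f * Φ3 f + ∑ f, W f * Φ4 f := by
      simp only [← Finset.sum_add_distrib, mul_add]
    have p1 : ((2 : ℝ) / 5) ^ H ≤ (2 / 5) ^ 10 :=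
      pow_le_pow_of_le_one (by norm_num) (by norm_num) hH
    have p2 : ((2 : ℝ) / 3) ^ H ≤ (2 / 3) ^ 10 :=
      pow_le_pow_of_le_one (by norm_num) (by norm_num) hH
    rw [e]
    norm_num at p1 p2 ⊢
    linarith
  obtain ⟨f, hf⟩ := exists_of_avg W (fun f => Φ1 f + Φ2 f + Φ3 f + Φ4 f) hW0 hW1 htot
  have n1 : ∀ j, 0 ≤ (2 : ℝ) ^ (ε * N / 2) * Pr (col j) (1 / 2) 1 f := fun j =>
    mul_nonneg (by positivity) (hPr0 _ _ _ _ (by norm_num) (by norm_num))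
  have n2 : ∀ j, 0 ≤ (2 : ℝ) ^ (-(2 * ε * N)) * Pr (col j) 2 1 f := fun j =>
    mul_nonneg (by positivity) (hPr0 _ _ _ _ (by norm_num) (by norm_num))
  have n3 : ∀ i, 0 ≤ (2 : ℝ) ^ (ε * D / 2) * Pr (row i) (1 / 2) 1 f := fun j =>
    mul_nonneg (by positivity) (hPr0 _ _ _ _ (by norm_num) (by norm_num))
  have n4 : ∀ p : Finset (Fin N) × Finset (Fin D), 0 ≤ Pr (p.1 ×ˢ p.2) 1 0 f := fun p =>
    hPr0 _ _ _ _ (by norm_num) (by norm_num)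
  have s1 : 0 ≤ Φ1 f := Finset.sum_nonneg fun j _ => n1 j
  have s2 : 0 ≤ Φ2 f := Finset.sum_nonneg fun j _ => n2 j
  have s3 : 0 ≤ Φ3 f := Finset.sum_nonneg fun j _ => n3 j
  have s4 : 0 ≤ Φ4 f := Finset.sum_nonneg fun j _ => n4 j
  have hcolf : ∀ j, ((col j).filter (fun p => f p = true)).card =
      (Finset.univ.filter (fun i => f (i, j) = true)).card := by
    intro j
    rw [← Finset.card_image_of_injective (Finset.univ.filter (fun i => f (i, j) = true))
      (Prod.mk_left_injective j)]
    congr 1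
    ext ⟨a, b⟩
    simp only [col, Finset.mem_filter, Finset.mem_product, Finset.mem_univ, true_and,
      Finset.mem_singleton, Finset.mem_image, Prod.mk.injEq]
    constructor
    · rintro ⟨rfl, h⟩; exact ⟨a, h, rfl, rfl⟩
    · rintro ⟨x, h, rfl, rfl⟩; exact ⟨rfl, h⟩
  have hrowf : ∀ i, ((row i).filter (fun p => f p = true)).card =
      (Finset.univ.filter (fun j => f (i, j) = true)).card := by
    intro i
    rw [← Finset.card_image_of_injective (Finset.univ.filter (fun j => f (i, j) = true))
      (Prod.mk_right_injective i)]
    congr 1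
    ext ⟨a, b⟩
    simp only [row, Finset.mem_filter, Finset.mem_product, Finset.mem_univ, and_true,
      Finset.mem_singleton, Finset.mem_image, Prod.mk.injEq, true_and]
    constructor
    · rintro ⟨rfl, h⟩; exact ⟨b, h, rfl, rfl⟩
    · rintro ⟨x, h, rfl, rfl⟩; exact ⟨rfl, h⟩
  have half : ∀ (a : ℝ) (m : ℕ), (2 : ℝ) ^ a * (1 / 2) ^ m < 1 → a ≤ m := by
    intro a m h
    have e : (2 : ℝ) ^ a * (1 / 2) ^ m = (2 : ℝ) ^ (a - m) := by
      rw [Real.rpow_sub (by norm_num), Real.rpow_natCast, one_div, inv_pow]; rfl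
    rw [e] at h
    by_contra hcon
    have := Real.one_le_rpow (x := 2) (by norm_num) (show 0 ≤ a - m by linarith)
    linarith
  have two : ∀ (a : ℝ) (m : ℕ), (2 : ℝ) ^ (-a) * 2 ^ m < 1 → m ≤ a := by
    intro a m h
    have e : (2 : ℝ) ^ (-a) * 2 ^ m = (2 : ℝ) ^ (m - a) := by
      rw [← Real.rpow_natCast, ← Real.rpow_add (by norm_num)]; ring_nf
    rw [e] at h
    by_contra hcon
    have := Real.one_le_rpow (x := 2) (by norm_num) (show 0 ≤ m - a by linarith)
    linarith
  refine ⟨fun i j => f (i, j), ?_, ?_, ?_⟩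
  · intro j
    constructor
    · apply half
      have := Finset.single_le_sum (fun j _ => n1 j) (Finset.mem_univ j)
      rw [← hcolf, ← prod_ite_one]
      change (2 : ℝ) ^ (ε * N / 2) * Pr (col j) (1 / 2) 1 f < 1
      have : _ ≤ Φ1 f := this
      linarith
    · apply two
      have := Finset.single_le_sum (fun j _ => n2 j) (Finset.mem_univ j)
      rw [← hcolf, ← prod_ite_one]
      change (2 : ℝ) ^ (-(2 * ε * N)) * Pr (col j) 2 1 f < 1
      have : _ ≤ Φ2 f := this
      linarith
  · intro i
    rw [show ε / 2 * D = ε * D / 2 by ring]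
    apply half
    have := Finset.single_le_sum (fun j _ => n3 j) (Finset.mem_univ i)
    rw [← hrowf, ← prod_ite_one]
    change (2 : ℝ) ^ (ε * D / 2) * Pr (row i) (1 / 2) 1 f < 1
    have : _ ≤ Φ3 f := this
    linarith
  · intro J hJ
    by_contra hcon
    push Not at hcon
    obtain ⟨I, hI, hIc⟩ := Finset.exists_subset_card_eq hcon.le
    have hmem : (I, J) ∈ PI ×ˢ PJ := by
      rw [Finset.mem_product, Finset.mem_powersetCard, Finset.mem_powersetCard]
      exact ⟨⟨Finset.subset_univ _, hIc⟩, Finset.subset_univ _, hJ⟩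
    have := Finset.single_le_sum (fun p _ => n4 p) hmem
    have hle : Pr (I ×ˢ J) 1 0 f ≤ Φ4 f := this
    have hone : Pr (I ×ˢ J) 1 0 f = 1 := by
      refine Finset.prod_eq_one ?_
      rintro ⟨i, j⟩ hij
      rw [Finset.mem_product] at hij
      have := (Finset.mem_filter.1 (hI hij.1)).2 j hij.2
      simp [this]
    linarith

end prob

lemma exists_code (N H : ℕ) (s : Finset (Fin N)) (hs : s.card ≤ 2 ^ H - 1) :
    ∃ g : Fin N → Fin H → Bool, Set.InjOn g s ∧ ∀ i, i ∈ s ↔ ∃ h, g i h = true := by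
  classical
  let V : Finset (Fin H → Bool) := Finset.univ.erase (fun _ => false)
  have hV : s.card ≤ V.card := by
    rw [Finset.card_erase_of_mem (Finset.mem_univ _), Finset.card_univ]
    simpa using hs
  obtain ⟨t, ht, htc⟩ := Finset.exists_subset_card_eq hV
  let e := Finset.equivOfCardEq htc.symm
  refine ⟨fun i => if hi : i ∈ s then (e ⟨i, hi⟩).1 else fun _ => false, ?_, ?_⟩
  · intro a ha b hb hab
    have ha' : a ∈ s := ha
    have hb' : b ∈ s := hb
    simp only [ha', hb', dif_pos] at hab
    have := e.injective (Subtype.ext hab)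
    simpa using this
  · intro i
    by_cases hi : i ∈ s
    · simp only [hi, dif_pos, true_iff]
      by_contra hcon
      push Not at hcon
      have hm := ht (e ⟨i, hi⟩).2
      rw [Finset.mem_erase] at hm
      apply hm.1
      funext h
      simpa using hcon h
    · simp [hi]

/-- There exist absolute constants `h₀ ∈ ℕ`, `c ∈ (0,1)`, `c' > 0` such
that for every `H ≥ h₀`, every `ε` with `2^{−cH} < ε < 1/(100H)`, and every
`ℓ ∈ {2, …, H}` with `ε^{−ℓ} ≤ 2^H`, setting `N = ⌊1/(6ε^ℓ)⌋`, there is a policy class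
`P` of cardinality `N` over the layered state space whose layer `h` consists of the
states `j[h] = (j, false)` and `j'[h] = (j, true)` for `j ∈ [2^{2H}]`, with binary
actions, satisfying: (1) every set `P_j = {π ∈ P : ∃ h < H, π(j[h]) = 1}` has
cardinality in `[εN/2, 2εN]`; (2) every `π ∈ P` lies in `P_j` for at least
`(ε/2)·2^{2H}` indices `j`; (3) every `π ∈ P` satisfies `π(j[h]) = π(j'[h])` for all
`j, h`, and for every `j`, the map `π ↦ (π(j[1]), …, π(j[H]))` is injective on `P_j`;
and (4) the spanning capacity satisfies `𝔠(P) ≤ c'·H^{4ℓ+2}`. -/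
theorem exists_hard_policy_class :
    ∃ (h₀ : ℕ) (c : ℝ), 0 < c ∧ c < 1 ∧ ∃ c' : ℝ, 0 < c' ∧
      ∀ H : ℕ, h₀ ≤ H →
      ∀ ε : ℝ, (2 : ℝ) ^ (-(c * (H : ℝ))) < ε → ε < 1 / (100 * (H : ℝ)) →
      ∀ ℓ : ℕ, 2 ≤ ℓ → ℓ ≤ H → 1 / ε ^ ℓ ≤ (2 : ℝ) ^ (H : ℕ) →
      ∃ P : Set (∀ _ : ℕ, Fin (2 ^ (2 * H)) × Bool → Bool),
        P.Finite ∧ P.ncard = ⌊1 / (6 * ε ^ ℓ)⌋₊ ∧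
        (∀ j : Fin (2 ^ (2 * H)),
          ε * (⌊1 / (6 * ε ^ ℓ)⌋₊ : ℝ) / 2 ≤
              (({π ∈ P | ∃ h < H, π h (j, false) = true}).ncard : ℝ) ∧
            (({π ∈ P | ∃ h < H, π h (j, false) = true}).ncard : ℝ) ≤
              2 * ε * (⌊1 / (6 * ε ^ ℓ)⌋₊ : ℝ)) ∧
        (∀ π ∈ P,
          ε / 2 * 2 ^ (2 * H) ≤
            (({j : Fin (2 ^ (2 * H)) | ∃ h < H, π h (j, false) = true}).ncard : ℝ)) ∧
        (∀ π ∈ P, ∀ j : Fin (2 ^ (2 * H)), ∀ h : ℕ, π h (j, false) = π h (j, true)) ∧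
        (∀ j : Fin (2 ^ (2 * H)),
          Set.InjOn (fun π : ∀ _ : ℕ, Fin (2 ^ (2 * H)) × Bool → Bool =>
              (fun h : Fin H => π h.1 (j, false)))
            {π ∈ P | ∃ h < H, π h (j, false) = true}) ∧
        ((spanCap H (fun _ => Fin (2 ^ (2 * H)) × Bool) Bool P : ℝ) ≤
          c' * (H : ℝ) ^ (4 * ℓ + 2)) := by
  refine ⟨10, 1 / 2, by norm_num, by norm_num, 2, by norm_num, ?_⟩
  intro H hH ε hε1 hε2 ℓ hl hlH hεl
  have h0 : 0 < ε := lt_trans (by positivity) hε1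
  have hHr : (10 : ℝ) ≤ H := by exact_mod_cast hH
  have hεH : ε * (100 * H) < 1 := by
    rwa [lt_div_iff₀ (by positivity)] at hε2
  have h1 : ε < 1 / 1000 := by nlinarith
  set N := ⌊1 / (6 * ε ^ ℓ)⌋₊ with hNdef
  have hpl : 0 < ε ^ ℓ := by positivity
  have hNle : (N : ℝ) ≤ 1 / (6 * ε ^ ℓ) := Nat.floor_le (by positivity)
  have hNgt : 1 / (6 * ε ^ ℓ) < N + 1 := Nat.lt_floor_add_one _
  have hNe : N * ε ^ ℓ ≤ 1 / 6 := by
    rw [le_div_iff₀ (by positivity)] at hNle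
    linarith
  have hl2 : ε ^ ℓ ≤ ε ^ 2 := pow_le_pow_of_le_one h0.le (by linarith) hl
  have hεl' : 1 ≤ 2 ^ H * ε ^ ℓ := by rwa [div_le_iff₀ hpl] at hεl
  have hNlt : (N : ℝ) ≤ 2 ^ H := by
    have h2 : (0 : ℝ) ≤ 2 ^ H := by positivity
    have : (N : ℝ) * ε ^ ℓ ≤ 2 ^ H * ε ^ ℓ := by linarith
    exact le_of_mul_le_mul_right this hpl
  have hN16 : 16 * (H : ℝ) ≤ ε * N := by
    have e1 : 1 < (N + 1) * (6 * ε ^ ℓ) := by rwa [div_lt_iff₀ (by positivity)] at hNgt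
    have e2 : ((N : ℝ) + 1) * (6 * ε ^ ℓ) ≤ (N + 1) * (6 * ε ^ 2) := by gcongr
    have e3 : 1 < (6 * (ε * N) + 6 * ε) * ε := by nlinarith
    by_contra hcon
    push Not at hcon
    nlinarith
  have hpow : ∀ n : ℕ, 10 ≤ n → 16 * n ≤ 2 ^ n := by
    intro n hn
    induction n, hn using Nat.le_induction with
    | base => norm_num
    | succ n hn ih => rw [pow_succ]; omega
  have hHpow : 16 * (H : ℝ) ≤ 2 ^ H := by exact_mod_cast hpow H hH
  have hDr : ((2 ^ (2 * H) : ℕ) : ℝ) = 2 ^ H * 2 ^ H := by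
    push_cast; rw [two_mul, pow_add]
  have hD16 : 16 * (H : ℝ) ≤ ε * (2 ^ (2 * H) : ℕ) := by
    rw [hDr]
    have e1 : ε ^ ℓ ≤ ε := by nlinarith
    have h2 : (0 : ℝ) < 2 ^ H := by positivity
    have e2 : (1 : ℝ) ≤ 2 ^ H * ε := hεl'.trans (by gcongr)
    nlinarith
  have hND : N ≤ 2 ^ (2 * H) := by
    have : N ≤ 2 ^ H := by exact_mod_cast hNlt
    exact this.trans (Nat.pow_le_pow_right (by norm_num) (by omega))
  obtain ⟨B, hcol, hrow, hblock⟩ := exists_matrix N (2 ^ (2 * H)) H ℓ ε h0 (by linarith) hN16 hD16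
    (by rw [pow_mul]; norm_num) hND hNe hl hH
  have hcode : ∀ j, ∃ g : Fin N → Fin H → Bool,
      Set.InjOn g (Finset.univ.filter (fun i => B i j = true)) ∧
      ∀ i, i ∈ (Finset.univ.filter (fun i => B i j = true)) ↔ ∃ h, g i h = true := by
    intro j
    apply exists_code
    have hc := (hcol j).2
    have h2 : (16 : ℝ) ≤ 2 ^ H := by linarith
    have : (((Finset.univ.filter (fun i => B i j = true)).card : ℝ) + 1) ≤ 2 ^ H := by nlinarith
    have : (Finset.univ.filter (fun i => B i j = true)).card + 1 ≤ 2 ^ H := by exact_mod_cast this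
    omega
  choose g hginj hgmem using hcode
  simp only [Finset.mem_filter, Finset.mem_univ, true_and] at hgmem
  let pol : Fin N → (∀ _ : ℕ, Fin (2 ^ (2 * H)) × Bool → Bool) := fun i h s =>
    if hh : h < H then g s.1 i ⟨h, hh⟩ else false
  have hpolH : ∀ i j b (h : Fin H), pol i h.1 (j, b) = g j i h := by
    intro i j b h
    simp [pol]
  have hpolB : ∀ i j, (∃ h < H, pol i h (j, false) = true) ↔ B i j = true := by
    intro i j
    rw [hgmem]
    constructor
    · rintro ⟨h, hh, hp⟩
      exact ⟨⟨h, hh⟩, by rw [← hpolH i j false]; exact hp⟩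
    · rintro ⟨h, hp⟩
      exact ⟨h.1, h.2, by rw [hpolH]; exact hp⟩
  have hinjj : ∀ j i i', B i j = true → B i' j = true →
      (∀ h : Fin H, pol i h.1 (j, false) = pol i' h.1 (j, false)) → i = i' := by
    intro j i i' h1 h2 h3
    refine hginj j (by simpa using h1) (by simpa using h2) ?_
    funext h
    rw [← hpolH i j false, ← hpolH i' j false, h3]
  have hrowpos : ∀ i, ∃ j, B i j = true := by
    intro i
    have h2 := hrow i
    have h3 : (0 : ℝ) < ((Finset.univ.filter (fun j => B i j = true)).card : ℝ) := by
      nlinarith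
    have h4 : 0 < (Finset.univ.filter (fun j => B i j = true)).card := by exact_mod_cast h3
    obtain ⟨j, hj⟩ := Finset.card_pos.1 h4
    exact ⟨j, (Finset.mem_filter.1 hj).2⟩
  have hpolinj : Function.Injective pol := by
    intro i i' hii
    obtain ⟨j, hj⟩ := hrowpos i
    have hj' : B i' j = true := by
      rw [← hpolB, ← hii, hpolB]; exact hj
    exact hinjj j i i' hj hj' (fun h => by rw [hii])
  have hPj : ∀ j, {π ∈ Set.range pol | ∃ h < H, π h (j, false) = true} =
      Set.image pol (Finset.univ.filter (fun i => B i j = true) : Finset (Fin N)) := by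
    intro j
    ext π
    simp only [Set.mem_setOf_eq, Set.mem_range, Set.mem_image, Finset.coe_filter,
      Finset.mem_univ, true_and]
    constructor
    · rintro ⟨⟨i, rfl⟩, h⟩
      exact ⟨i, (hpolB i j).1 h, rfl⟩
    · rintro ⟨i, hi, rfl⟩
      exact ⟨⟨i, rfl⟩, (hpolB i j).2 hi⟩
  refine ⟨Set.range pol, Set.finite_range _, ?_, ?_, ?_, ?_, ?_, ?_⟩
  · rw [← Set.image_univ, Set.ncard_image_of_injective _ hpolinj, Set.ncard_univ,
      Nat.card_eq_fintype_card, Fintype.card_fin]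
  · intro j
    rw [hPj, Set.ncard_image_of_injective _ hpolinj, Set.ncard_coe_finset]
    exact hcol j
  · rintro _ ⟨i, rfl⟩
    have e : {j : Fin (2 ^ (2 * H)) | ∃ h < H, pol i h (j, false) = true} =
        (Finset.univ.filter (fun j => B i j = true) : Finset (Fin (2 ^ (2 * H)))) := by
      ext j
      simp only [Set.mem_setOf_eq, Finset.coe_filter, Finset.mem_univ, true_and]
      exact hpolB i j
    rw [e, Set.ncard_coe_finset]
    have := hrow i
    push_cast at this
    exact this
  · rintro _ ⟨i, rfl⟩ j h
    rfl
  · intro j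
    rintro _ ⟨⟨i, rfl⟩, hi⟩ _ ⟨⟨i', rfl⟩, hi'⟩ heq
    rw [hinjj j i i' ((hpolB i j).1 hi) ((hpolB i' j).1 hi') (fun h => congrFun heq h)]
  · have : Inhabited (Fin (2 ^ (2 * H))) := ⟨⟨0, by positivity⟩⟩
    have hb := spanCap_bound pol B H ℓ (H * ℓ) (by omega) hlH (Nat.mul_pos (by omega) (by omega))
      (by
        intro i v s hv hs
        have : pol i v (s.1, false) = true := hs
        exact (hpolB i s.1).1 ⟨v, hv, this⟩) (fun J hJ => by convert hblock J hJ)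
    have hb2 : 2 * (H * ℓ * (4 * H ^ 3) ^ ℓ) ≤ 2 * H ^ (4 * ℓ + 2) := by
      have e1 : 4 * H ^ 3 ≤ H ^ 4 := by
        rw [pow_succ' H 3]; exact Nat.mul_le_mul_right _ (by omega)
      calc 2 * (H * ℓ * (4 * H ^ 3) ^ ℓ) ≤ 2 * (H * H * (H ^ 4) ^ ℓ) := by gcongr
        _ = 2 * H ^ (4 * ℓ + 2) := by rw [← pow_mul]; ring
    have hb3 := hb.trans hb2
    exact_mod_cast hb3
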